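/- Let G be a connected graph with an injective vertex priority function p : V(G) → ℝ. Let C be a cycle in G and let e be an edge of C incident to the minimum-priority vertex of C. Then Ind(G,p) = Ind(G − e, p) (note that G − e is connected since e lies on a cycle). -/

import Mathlib

/-- A rooted tree on a node set `α`, given by its root and parent function
(the root is its own parent, and every node reaches the root by iterating `parent`). -/
structure RTree (α : Type*) where
  root : α
  parent : α → α
  parent_root : parent root = root
  reaches_root : ∀ v, ∃ k, parent^[k] v = root

namespace RTree

variable {α : Type*}

/-- `u` is a (weak) ancestor of `v` in `T`. -/
def ancestor (T : RTree α) (u v : α) : Prop := ∃ k, T.parent^[k] v = u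

/-- `u` is a proper ancestor of `v` in `T`. -/
def properAncestor (T : RTree α) (u v : α) : Prop := T.ancestor u v ∧ u ≠ v

/-- The node set of the subtree `T_v` of `T` rooted at `v`,
i.e. `v` together with all of its descendants. -/
def subtree (T : RTree α) (v : α) : Set α := {u | T.ancestor v u}

/-- A leaf of `T` is a node with no children. -/
def IsLeaf (T : RTree α) (v : α) : Prop := ∀ u, T.parent u = v → u = v

end RTree

/-- `T` is an elimination tree on the (connected) graph `G`: every subtree of `T` induces a
connected subgraph of `G`, and every edge of `G` joins an ancestor-descendant pair of `T`.
(For connected `G` this is equivalent to the recursive definition: some vertex `r` is the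
root, and the child subtrees of `r` are elimination trees on the components of `G − r`.) -/
def IsElimTree {α : Type*} (G : SimpleGraph α) (T : RTree α) : Prop :=
  (∀ v : α, (G.induce (T.subtree v)).Connected) ∧
  (∀ u v : α, G.Adj u v → T.ancestor u v ∨ T.ancestor v u)

/-- `T` is the Cartesian tree `Ind(G,p)`: the (unique) elimination tree on `G` in which
`p(u) < p(v)` whenever `u` is a proper ancestor of `v`. -/
def IsCartesianTree {α : Type*} (G : SimpleGraph α) (p : α → ℝ) (T : RTree α) : Prop :=
  IsElimTree G T ∧ ∀ u v : α, T.properAncestor u v → p u < p v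

/-- `T` is a rooting of the tree `G`: the parent-child pairs of `T` are exactly the edges
of `G`. -/
def IsRooting {α : Type*} (G : SimpleGraph α) (T : RTree α) : Prop :=
  ∀ u v : α, G.Adj u v ↔ ((T.parent u = v ∧ u ≠ v) ∨ (T.parent v = u ∧ v ≠ u))

/-- `p` is a `T`-monotone priority function: `p` is injective and `p(v) < p(u)` whenever
`u` is a proper ancestor of `v` in `T`. -/
def IsMonotonePriority {α : Type*} (T : RTree α) (p : α → ℝ) : Prop :=
  Function.Injective p ∧ ∀ u v : α, T.properAncestor u v → p v < p u

namespace RTree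

variable {α : Type*} {T : RTree α}

theorem ancestor_refl (T : RTree α) (u : α) : T.ancestor u u := ⟨0, rfl⟩

theorem ancestor.trans {u v w : α} (huv : T.ancestor u v) (hvw : T.ancestor v w) :
    T.ancestor u w := by
  obtain ⟨k, rfl⟩ := huv
  obtain ⟨l, rfl⟩ := hvw
  exact ⟨k + l, Function.iterate_add_apply _ _ _ _⟩

/-- Any two ancestors of the same node are comparable. -/
theorem ancestor.comparable {u v w : α} (hu : T.ancestor u w) (hv : T.ancestor v w) :
    T.ancestor u v ∨ T.ancestor v u := by
  obtain ⟨k, rfl⟩ := hu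
  obtain ⟨l, rfl⟩ := hv
  rcases le_total k l with h | h
  · refine .inr ⟨l - k, ?_⟩
    rw [← Function.iterate_add_apply, Nat.sub_add_cancel h]
  · refine .inl ⟨k - l, ?_⟩
    rw [← Function.iterate_add_apply, Nat.sub_add_cancel h]

/-- A walk starting below `v`, along edges joining comparable nodes of priority at least
that of `v`, stays below `v`. -/
theorem ancestor_of_mem_support {p : α → ℝ} {K : SimpleGraph α} {v : α}
    (hT : ∀ x y, T.properAncestor x y → p x < p y)
    (hK : ∀ x y, K.Adj x y → T.ancestor x y ∨ T.ancestor y x)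
    (hmin : ∀ x y, K.Adj x y → p v ≤ p y) {x y : α} (P : K.Walk x y) (hx : T.ancestor v x) :
    ∀ z ∈ P.support, T.ancestor v z := by
  induction P with
  | nil => simpa using hx
  | @cons x y w h P ih =>
    have hy : T.ancestor v y := by
      rcases hK x y h with hxy | hyx
      · exact hx.trans hxy
      · rcases hx.comparable hyx with hvy | hyv
        · exact hvy
        · by_contra hvy
          have hne : y ≠ v := fun h => hvy (h ▸ T.ancestor_refl v)
          exact absurd (hT y v ⟨hyv, hne⟩) (hmin x y h).not_gt
    intro z hz
    rw [SimpleGraph.Walk.support_cons, List.mem_cons] at hz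
    rcases hz with rfl | hz
    · exact hx
    · exact ih hy z hz

end RTree

namespace SimpleGraph

variable {α : Type*}

/-- Connectedness passes to a graph in which the endpoints of every edge stay reachable. -/
theorem Connected.of_adj_reachable {G H : SimpleGraph α} (hG : G.Connected)
    (h : ∀ x y, G.Adj x y → H.Reachable x y) : H.Connected := by
  have := hG.nonempty
  refine ⟨fun x y => ?_⟩
  obtain ⟨P⟩ := hG.preconnected x y
  induction P with
  | nil => rfl
  | cons hadj _ ih => exact (h _ _ hadj).trans ih

/-- The endpoints of an edge of a cycle are joined along the remaining edges of the cycle. -/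
theorem Walk.IsCycle.reachable_deleteEdges_fromEdgeSet {G : SimpleGraph α} {a : α}
    {C : G.Walk a a} (hC : C.IsCycle) {v w : α} (he : s(v, w) ∈ C.edges) :
    ((fromEdgeSet {e | e ∈ C.edges}).deleteEdges {s(v, w)}).Reachable v w := by
  have hmem : ∀ e ∈ C.edges, e ∈ (fromEdgeSet {e | e ∈ C.edges}).edgeSet := fun e h => by
    rw [edgeSet_fromEdgeSet]
    exact ⟨h, G.not_isDiag_of_mem_edgeSet (C.edges_subset_edgeSet h)⟩
  refine (adj_and_reachable_delete_edges_iff_exists_cycle.mpr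
    ⟨a, C.transfer _ hmem, hC.transfer hmem, ?_⟩).2
  rwa [Walk.edges_transfer]

end SimpleGraph

/-- Let `C` be a cycle in a connected graph `G` with injective vertex priorities `p`, and
let `e` be an edge of `C` incident to the minimum-priority vertex of `C`. Then
`Ind(G,p) = Ind(G − e, p)`. -/
theorem cartesianTree_deleteEdge_of_cycle {α : Type*} [Fintype α]
    (G : SimpleGraph α) (hG : G.Connected) (p : α → ℝ) (hp : Function.Injective p)
    {a : α} (C : G.Walk a a) (hC : C.IsCycle)
    (v : α) (hv : v ∈ C.support) (hvmin : ∀ x ∈ C.support, p v ≤ p x)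
    (e : Sym2 α) (he : e ∈ C.edges) (hve : v ∈ e) :
    ∀ T : RTree α, IsCartesianTree G p T ↔ IsCartesianTree (G.deleteEdges {e}) p T := by
  classical
  intro T
  obtain ⟨w, rfl⟩ := Sym2.mem_iff_exists.mp hve
  set K := (SimpleGraph.fromEdgeSet {e | e ∈ C.edges}).deleteEdges {s(v, w)} with hKdef
  obtain ⟨P⟩ : K.Reachable v w := hC.reachable_deleteEdges_fromEdgeSet he
  have hedge : ∀ x y, K.Adj x y → s(x, y) ∈ C.edges := fun x y h => by
    rw [hKdef, SimpleGraph.deleteEdges_adj, SimpleGraph.fromEdgeSet_adj] at h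
    exact h.1.1
  have hKH : K ≤ G.deleteEdges {s(v, w)} := fun x y h => by
    rw [SimpleGraph.deleteEdges_adj]
    refine ⟨C.adj_of_mem_edges (hedge x y h), ?_⟩
    rw [hKdef, SimpleGraph.deleteEdges_adj] at h
    exact h.2
  have hHG : G.deleteEdges {s(v, w)} ≤ G := SimpleGraph.deleteEdges_le _
  have hmin : ∀ x y, K.Adj x y → p v ≤ p y := fun x y h =>
    hvmin y (C.snd_mem_support_of_mem_edges (hedge x y h))
  have hbelow (hT : ∀ x y, T.properAncestor x y → p x < p y)
      (hK : ∀ x y, K.Adj x y → T.ancestor x y ∨ T.ancestor y x) :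
      ∀ z ∈ P.support, T.ancestor v z :=
    T.ancestor_of_mem_support hT hK hmin P (T.ancestor_refl v)
  constructor
  · rintro ⟨⟨hconn, hcomp⟩, hT⟩
    refine ⟨⟨fun u => ?_, fun x y h => hcomp x y (hHG h)⟩, hT⟩
    have hP := hbelow hT fun x y h => hcomp x y (hHG (hKH h))
    have hreach (hu : T.ancestor u v) (hw : T.ancestor u w) :
        ((G.deleteEdges {s(v, w)}).induce (T.subtree u)).Reachable ⟨v, hu⟩ ⟨w, hw⟩ :=
      ⟨(P.mapLe hKH).induce (T.subtree u) fun z hz =>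
        hu.trans (hP z (by simpa using hz))⟩
    refine (hconn u).of_adj_reachable ?_
    rintro ⟨x, hx⟩ ⟨y, hy⟩ hxy
    by_cases hxe : s(x, y) = s(v, w)
    · rcases Sym2.eq_iff.mp hxe with ⟨rfl, rfl⟩ | ⟨rfl, rfl⟩
      · exact hreach hx hy
      · exact (hreach hy hx).symm
    · refine SimpleGraph.Adj.reachable ?_
      rw [SimpleGraph.comap_adj] at hxy ⊢
      exact SimpleGraph.deleteEdges_adj.mpr ⟨hxy, hxe⟩
  · rintro ⟨⟨hconn, hcomp⟩, hT⟩
    refine ⟨⟨fun u => (hconn u).mono (SimpleGraph.comap_monotone _ hHG), fun x y h => ?_⟩, hT⟩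
    have hvw := hbelow hT (fun x y h => hcomp x y (hKH h)) w P.end_mem_support
    by_cases hxe : s(x, y) = s(v, w)
    · rcases Sym2.eq_iff.mp hxe with ⟨rfl, rfl⟩ | ⟨rfl, rfl⟩
      · exact .inl hvw
      · exact .inr hvw
    · exact hcomp x y (SimpleGraph.deleteEdges_adj.mpr ⟨h, hxe⟩)
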